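/- arXiv:1711.01193 — 4 statements merged into one kernel-verified Lean document; each statement's English description precedes it below -/
import Mathlib

section
/- Second-order expansion for formation: let p and q be probability vectors of dimension d with p flat, D(p) > 0, D(q) > 0, and let ε ∈ (0,1). Then R*_0(n,ε) = (1/D(q))·[D(p) + √(D(p)·V(q)/(D(q)·n))·Φ^{-1}(ε)] + o(1/√n) as n → ∞. -/
open Finset Filter

noncomputable section

/-- A probability vector: nonnegative entries summing to 1. -/
def IsProbVec {ι : Type*} [Fintype ι] (p : ι → ℝ) : Prop :=
  (∀ i, 0 ≤ p i) ∧ ∑ i, p i = 1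

/-- The sum of the `k` largest entries of `p`: the largest sum over subsets of at
most `k` indices (for nonnegative vectors this equals the sorted partial sum,
with zero padding beyond the dimension). -/
def kMaxSum {ι : Type*} [Fintype ι] (p : ι → ℝ) (k : ℕ) : ℝ :=
  (Finset.univ.powerset.filter (fun s : Finset ι => s.card ≤ k)).sup'
    ⟨∅, by simp⟩ (fun s => ∑ i ∈ s, p i)

/-- `p ≻ q`: for every `k`, the sum of the `k` largest entries of `p` is at least
that of `q` (dimensions may differ, the shorter padded with zeros). -/
def Majorises {ι κ : Type*} [Fintype ι] [Fintype κ] (p : ι → ℝ) (q : κ → ℝ) : Prop :=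
  ∀ k : ℕ, kMaxSum q k ≤ kMaxSum p k

/-- Fidelity `F(p,q) = (Σ_i √(p_i q_i))²`. -/
def fidelity {ι : Type*} [Fintype ι] (p q : ι → ℝ) : ℝ :=
  (∑ i, Real.sqrt (p i * q i)) ^ 2

/-- Infidelity `δ(p,q) = 1 - F(p,q)`. -/
def infid {ι : Type*} [Fintype ι] (p q : ι → ℝ) : ℝ := 1 - fidelity p q

/-- The `n`-fold tensor (Kronecker) power of `a`, as a vector indexed by
`Fin n → Fin d` (a probability vector of dimension `d^n`). -/
def tensorPow {d : ℕ} (a : Fin d → ℝ) (n : ℕ) : (Fin n → Fin d) → ℝ :=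
  fun f => ∏ j, a (f j)

/-- Shannon entropy `H(p) = -Σ_i p_i log p_i`. -/
def shannonH {ι : Type*} [Fintype ι] (p : ι → ℝ) : ℝ := -∑ i, p i * Real.log (p i)

/-- Entropy variance `V(p) = Σ_i p_i (-log p_i - H(p))²`. -/
def entVar {ι : Type*} [Fintype ι] (p : ι → ℝ) : ℝ :=
  ∑ i, p i * (-Real.log (p i) - shannonH p) ^ 2

/-- Relative entropy to the uniform distribution: `D(p) = log d - H(p)`. -/
def relD {d : ℕ} (p : Fin d → ℝ) : ℝ := Real.log d - shannonH p

/-- Density of the normal distribution with mean `μ` and variance `v`. -/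
def normPDF (μ v x : ℝ) : ℝ :=
  Real.exp (-((x - μ) ^ 2) / (2 * v)) / Real.sqrt (2 * Real.pi * v)

/-- Cumulative distribution function `Φ_{μ,v}` of the normal distribution. -/
def normCDF (μ v x : ℝ) : ℝ := ∫ t in Set.Iic x, normPDF μ v t

/-- The standard normal cumulative distribution function `Φ`. -/
def Phi (x : ℝ) : ℝ := normCDF 0 1 x

/-- A vector is flat if all of its non-zero entries are equal. -/
def IsFlat {ι : Type*} [Fintype ι] (p : ι → ℝ) : Prop :=
  ∀ i j, p i ≠ 0 → p j ≠ 0 → p i = p j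

/-- `P ≻_ε Q`: `P` ε-post-majorises `Q`, i.e. there is a probability vector `Q̃`
with `P ≻ Q̃` and `δ(Q,Q̃) ≤ ε`. -/
def PostMaj {ι κ : Type*} [Fintype ι] [Fintype κ] (ε : ℝ) (P : ι → ℝ) (Q : κ → ℝ) : Prop :=
  ∃ Qt : κ → ℝ, IsProbVec Qt ∧ Majorises P Qt ∧ infid Q Qt ≤ ε

/-- The inverse of the standard normal cumulative distribution function. -/
def PhiInv (ε : ℝ) : ℝ := Function.invFun Phi ε

section Majorisation

variable {ι κ : Type*} [Fintype ι] [Fintype κ]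

lemma sum_le_kMaxSum (p : ι → ℝ) {k : ℕ} {s : Finset ι} (hs : s.card ≤ k) :
    ∑ i ∈ s, p i ≤ kMaxSum p k :=
  Finset.le_sup' (fun s : Finset ι => ∑ i ∈ s, p i) (by simpa using hs)

lemma kMaxSum_le {p : ι → ℝ} {k : ℕ} {C : ℝ}
    (h : ∀ s : Finset ι, s.card ≤ k → ∑ i ∈ s, p i ≤ C) : kMaxSum p k ≤ C := by
  refine Finset.sup'_le _ _ fun s hs => h s ?_
  simpa using hs

lemma Majorises.le_of_forall_le {P : ι → ℝ} {Q : κ → ℝ} (h : Majorises P Q) {c : ℝ} (hc : 0 ≤ c)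
    (hP : ∀ i, P i ≤ c) (j : κ) : Q j ≤ c := by
  have h1 : Q j ≤ kMaxSum Q 1 := by
    simpa using sum_le_kMaxSum Q (s := {j}) (k := 1) (by simp)
  refine h1.trans ((h 1).trans (kMaxSum_le fun s hs => ?_))
  calc ∑ i ∈ s, P i ≤ s.card • c := Finset.sum_le_card_nsmul _ _ _ fun i _ => hP i
    _ ≤ 1 • c := by gcongr
    _ = c := one_smul _ _

lemma majorises_of_flat {P : ι → ℝ} (hP : IsProbVec P) {c : ℝ} (h : ∀ i, P i = 0 ∨ P i = c)
    {Q : κ → ℝ} (hQ : IsProbVec Q) (hQc : ∀ j, Q j ≤ c) : Majorises P Q := by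
  classical
  intro k
  refine kMaxSum_le fun s hs => ?_
  set T : Finset ι := Finset.univ.filter fun i => P i ≠ 0 with hT
  have hTc : ∀ i ∈ T, P i = c := fun i hi => (h i).resolve_left (by simpa [hT] using hi)
  have hsum : ∑ i ∈ T, P i = 1 := by
    rw [hT, Finset.sum_filter_ne_zero, hP.2]
  rcases le_total k T.card with hk | hk
  · obtain ⟨U, hU, hUk⟩ := Finset.exists_subset_card_eq hk
    have h1 : ∑ i ∈ U, P i = k * c := by
      rw [Finset.sum_congr rfl fun i hi => hTc i (hU hi)]; simp [hUk]
    have hc : 0 ≤ c := by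
      rcases isEmpty_or_nonempty κ with hκ | ⟨⟨j⟩⟩
      · simp [IsProbVec] at hQ
      · exact (hQ.1 j).trans (hQc j)
    calc ∑ j ∈ s, Q j ≤ s.card • c := Finset.sum_le_card_nsmul _ _ _ fun j _ => hQc j
      _ ≤ k • c := by gcongr
      _ = ∑ i ∈ U, P i := by rw [h1, nsmul_eq_mul]
      _ ≤ _ := sum_le_kMaxSum P hUk.le
  · calc ∑ j ∈ s, Q j ≤ ∑ j, Q j :=
        Finset.sum_le_sum_of_subset_of_nonneg (Finset.subset_univ _) fun j _ _ => hQ.1 j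
      _ = ∑ i ∈ T, P i := by rw [hsum, hQ.2]
      _ ≤ _ := sum_le_kMaxSum P hk

/-- Conditioning a probability vector on a set of mass `M` gives a vector at fidelity `M`. -/
lemma exists_probVec_of_mass {Q : κ → ℝ} (hQ : IsProbVec Q) (A : Finset κ) {M : ℝ} (hM : 0 < M)
    (hA : M ≤ ∑ j ∈ A, Q j) {c : ℝ} (hc : 0 ≤ c) (hAc : ∀ j ∈ A, Q j ≤ c * M) :
    ∃ Qt : κ → ℝ, IsProbVec Qt ∧ (∀ j, Qt j ≤ c) ∧ M ≤ fidelity Q Qt := by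
  classical
  set N := ∑ j ∈ A, Q j with hN
  have hN0 : 0 < N := hM.trans_le hA
  refine ⟨fun j => if j ∈ A then Q j / N else 0, ⟨fun j => ?_, ?_⟩, fun j => ?_, ?_⟩
  · show 0 ≤ if j ∈ A then Q j / N else 0
    split_ifs
    · exact div_nonneg (hQ.1 j) hN0.le
    · rfl
  · rw [Finset.sum_ite_mem, Finset.univ_inter, ← Finset.sum_div, ← hN, div_self hN0.ne']
  · show (if j ∈ A then Q j / N else 0) ≤ c
    split_ifs with hj
    · rw [div_le_iff₀ hN0]
      exact (hAc j hj).trans (by gcongr)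
    · exact hc
  · have h1 : ∀ j, √(Q j * (if j ∈ A then Q j / N else 0)) = if j ∈ A then Q j / √N else 0 := by
      intro j
      split_ifs
      · rw [← mul_div_assoc, Real.sqrt_div (mul_self_nonneg _), Real.sqrt_mul_self (hQ.1 j)]
      · simp
    unfold fidelity
    simp_rw [h1]
    rw [Finset.sum_ite_mem, Finset.univ_inter, ← Finset.sum_div, ← hN, div_pow,
      Real.sq_sqrt hN0.le, sq, mul_div_assoc, div_self hN0.ne', mul_one]
    exact hA

lemma fidelity_le_of_le {Q Qt : κ → ℝ} (hQ : IsProbVec Q) (hQt : IsProbVec Qt) {c : ℝ}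
    (hc : ∀ j, Qt j ≤ c) (s : ℝ) :
    fidelity Q Qt ≤ (√(∑ j with Q j ≤ c * Real.exp s, Q j) + Real.exp (-s / 2)) ^ 2 := by
  classical
  unfold fidelity
  refine pow_le_pow_left₀ (Finset.sum_nonneg fun _ _ => Real.sqrt_nonneg _) ?_ 2
  rw [← Finset.sum_filter_add_sum_filter_not Finset.univ (fun j => Q j ≤ c * Real.exp s)]
  refine add_le_add ?_ ?_
  · set A : Finset κ := Finset.univ.filter fun j => Q j ≤ c * Real.exp s
    have h1 : ∑ j ∈ A, Qt j ≤ 1 := by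
      rw [← hQt.2]
      exact Finset.sum_le_sum_of_subset_of_nonneg (Finset.subset_univ _) fun j _ _ => hQt.1 j
    calc ∑ j ∈ A, √(Q j * Qt j) = ∑ j ∈ A, √(Q j) * √(Qt j) :=
          Finset.sum_congr rfl fun j _ => Real.sqrt_mul (hQ.1 j) _
      _ ≤ √(∑ j ∈ A, Q j) * √(∑ j ∈ A, Qt j) :=
          Real.sum_sqrt_mul_sqrt_le _ (fun j => hQ.1 j) (fun j => hQt.1 j)
      _ ≤ √(∑ j ∈ A, Q j) * 1 := by
          gcongr
          exact Real.sqrt_le_one.2 h1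
      _ = _ := mul_one _
  · calc ∑ j with ¬ Q j ≤ c * Real.exp s, √(Q j * Qt j)
        ≤ ∑ j with ¬ Q j ≤ c * Real.exp s, Q j * Real.exp (-s / 2) := by
          refine Finset.sum_le_sum fun j hj => ?_
          have hj' : c * Real.exp s < Q j := by simpa using hj
          have h2 : Qt j ≤ Q j * Real.exp (-s) := by
            refine (hc j).trans ?_
            rw [Real.exp_neg, ← div_eq_mul_inv, le_div_iff₀ (Real.exp_pos s)]
            exact hj'.le
          refine Real.sqrt_le_iff.2 ⟨mul_nonneg (hQ.1 j) (Real.exp_pos _).le, ?_⟩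
          have h3 : Real.exp (-s / 2) ^ 2 = Real.exp (-s) := by
            rw [← Real.exp_nat_mul]; congr 1; push_cast; ring
          rw [mul_pow, h3, sq, mul_assoc]
          exact mul_le_mul_of_nonneg_left h2 (hQ.1 j)
      _ ≤ ∑ j, Q j * Real.exp (-s / 2) :=
          Finset.sum_le_sum_of_subset_of_nonneg (Finset.subset_univ _) fun j _ _ =>
            mul_nonneg (hQ.1 j) (Real.exp_pos _).le
      _ = Real.exp (-s / 2) := by rw [← Finset.sum_mul, hQ.2, one_mul]

end Majorisation

section Gaussian

open MeasureTheory ProbabilityTheory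

lemma normPDF_zero_one : normPDF 0 1 = gaussianPDFReal 0 1 := by
  ext x
  simp [normPDF, gaussianPDFReal, div_eq_inv_mul]

lemma Phi_eq (x : ℝ) : Phi x = (gaussianReal 0 1).real (Set.Iic x) := by
  rw [Measure.real, gaussianReal_apply_eq_integral 0 one_ne_zero, ENNReal.toReal_ofReal, Phi,
    normCDF, normPDF_zero_one]
  exact integral_nonneg fun _ => gaussianPDFReal_nonneg _ _ _

lemma Phi_sub_Phi (x y : ℝ) : Phi y - Phi x = ∫ t in x..y, gaussianPDFReal 0 1 t := by
  unfold Phi normCDF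
  rw [normPDF_zero_one]
  exact intervalIntegral.integral_Iic_sub_Iic (integrable_gaussianPDFReal 0 1).integrableOn
    (integrable_gaussianPDFReal 0 1).integrableOn

lemma Phi_strictMono : StrictMono Phi := by
  intro x y hxy
  have h : 0 < ∫ t in x..y, gaussianPDFReal 0 1 t :=
    intervalIntegral.intervalIntegral_pos_of_pos
      (integrable_gaussianPDFReal 0 1).intervalIntegrable
      (fun t => gaussianPDFReal_pos 0 1 t one_ne_zero) hxy
  rw [← Phi_sub_Phi] at h
  linarith

lemma continuous_Phi : Continuous Phi := by
  have h : Phi = fun x => Phi 0 + ∫ t in (0 : ℝ)..x, gaussianPDFReal 0 1 t := by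
    ext x
    rw [← Phi_sub_Phi]
    ring
  rw [h]
  exact continuous_const.add (intervalIntegral.continuous_primitive
    (fun a b => (integrable_gaussianPDFReal 0 1).intervalIntegrable) 0)

lemma Phi_PhiInv {ε : ℝ} (hε : ε ∈ Set.Ioo (0 : ℝ) 1) : Phi (PhiInv ε) = ε := by
  refine Function.invFun_eq ?_
  have hcdf : Phi = cdf (gaussianReal 0 1) := by
    ext x
    rw [Phi_eq, cdf_eq_real]
  have hbot : Tendsto Phi atBot (nhds 0) := hcdf ▸ tendsto_cdf_atBot _
  have htop : Tendsto Phi atTop (nhds 1) := hcdf ▸ tendsto_cdf_atTop _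
  obtain ⟨a, ha⟩ := (hbot.eventually_lt_const hε.1).exists
  obtain ⟨b, hb⟩ := (htop.eventually_const_lt hε.2).exists
  exact mem_range_of_exists_le_of_exists_ge continuous_Phi ⟨a, ha.le⟩ ⟨b, hb.le⟩

lemma gaussianReal_real_Iic_sqrt_mul {V : NNReal} (hV : V ≠ 0) (x : ℝ) :
    (gaussianReal 0 V).real (Set.Iic (√V * x)) = Phi x := by
  have hV' : 0 < √(V : ℝ) := Real.sqrt_pos.2 (by positivity)
  have h : gaussianReal 0 V = (gaussianReal 0 1).map (√(V : ℝ) * ·) := by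
    rw [gaussianReal_map_const_mul]
    congr 1
    · simp
    · ext; simp
  rw [h, map_measureReal_apply (by fun_prop) measurableSet_Iic, Phi_eq]
  congr 1
  ext y
  simp [mul_le_mul_iff_right₀ hV']

lemma gaussianReal_real_Iic_lt {V : NNReal} {ε δ : ℝ} (hε : ε ∈ Set.Ioo (0 : ℝ) 1) (hδ : 0 < δ) :
    (gaussianReal 0 V).real (Set.Iic (√V * PhiInv ε - δ)) < ε := by
  rcases eq_or_ne V 0 with rfl | hV
  · simpa [Measure.real, Set.indicator, hδ.not_ge] using hε.1
  · have hV' : 0 < √(V : ℝ) := Real.sqrt_pos.2 (by positivity)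
    have h : √(V : ℝ) * PhiInv ε - δ = √V * (PhiInv ε - δ / √V) := by field_simp
    rw [h, gaussianReal_real_Iic_sqrt_mul hV]
    conv_rhs => rw [← Phi_PhiInv hε]
    exact Phi_strictMono (sub_lt_self _ (by positivity))

lemma gaussianReal_real_Ici_lt {V : NNReal} {ε δ : ℝ} (hε : ε ∈ Set.Ioo (0 : ℝ) 1) (hδ : 0 < δ) :
    (gaussianReal 0 V).real (Set.Ici (√V * PhiInv ε + δ)) < 1 - ε := by
  rcases eq_or_ne V 0 with rfl | hV
  · simpa [Measure.real, Set.indicator, hδ.not_ge] using hε.2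
  · have hV' : 0 < √(V : ℝ) := Real.sqrt_pos.2 (by positivity)
    have h : √(V : ℝ) * PhiInv ε + δ / 2 = √V * (PhiInv ε + δ / 2 / √V) := by field_simp
    have h1 : (gaussianReal 0 V).real (Set.Ici (√V * PhiInv ε + δ)) ≤
        (gaussianReal 0 V).real (Set.Iic (√V * PhiInv ε + δ / 2))ᶜ := by
      refine measureReal_mono fun x hx => ?_
      simp only [Set.mem_Ici, Set.mem_compl_iff, Set.mem_Iic, not_le] at hx ⊢
      linarith
    rw [probReal_compl_eq_one_sub measurableSet_Iic, h, gaussianReal_real_Iic_sqrt_mul hV] at h1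
    have h2 : Phi (PhiInv ε) < Phi (PhiInv ε + δ / 2 / √V) :=
      Phi_strictMono (lt_add_of_pos_right _ (by positivity))
    rw [Phi_PhiInv hε] at h2
    linarith

end Gaussian

section Tail

open MeasureTheory ProbabilityTheory

variable {d : ℕ}

/-- The information content of a string of letters drawn from `q`. -/
def surprisal (q : Fin d → ℝ) {m : ℕ} (f : Fin m → Fin d) : ℝ := ∑ j, -Real.log (q (f j))

/-- The probability that the information content of `m` independent letters is at least `x`. -/
def tailMass (q : Fin d → ℝ) (m : ℕ) (x : ℝ) : ℝ :=
  ∑ f : Fin m → Fin d with x ≤ surprisal q f, tensorPow q m f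

/-- The law of a single letter. -/
def letterLaw (q : Fin d → ℝ) : Measure (Fin d) :=
  ∑ i, ENNReal.ofReal (q i) • Measure.dirac i

lemma letterLaw_singleton (q : Fin d → ℝ) (i : Fin d) :
    letterLaw q {i} = ENNReal.ofReal (q i) := by
  simp [letterLaw, Set.indicator, Finset.sum_ite_eq']

lemma isProbabilityMeasure_letterLaw {q : Fin d → ℝ} (hq : IsProbVec q) :
    IsProbabilityMeasure (letterLaw q) := by
  constructor
  simp only [letterLaw, Measure.coe_finsetSum, Finset.sum_apply, Measure.smul_apply,
    measure_univ, smul_eq_mul, mul_one]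
  rw [← ENNReal.ofReal_sum_of_nonneg fun i _ => hq.1 i, hq.2, ENNReal.ofReal_one]

lemma integral_letterLaw {q : Fin d → ℝ} (hq : IsProbVec q) (g : Fin d → ℝ) :
    ∫ i, g i ∂letterLaw q = ∑ i, q i * g i := by
  have := isProbabilityMeasure_letterLaw hq
  rw [integral_fintype (Integrable.of_finite)]
  simp [Measure.real, letterLaw_singleton, ENNReal.toReal_ofReal (hq.1 _)]

lemma infinitePi_letterLaw_real {q : Fin d → ℝ} (hq : IsProbVec q) (m : ℕ)
    [IsProbabilityMeasure (letterLaw q)] (p : (Fin m → Fin d) → Prop) [DecidablePred p] :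
    (Measure.infinitePi fun _ : ℕ => letterLaw q).real {ω | p fun j => ω j} =
      ∑ f with p f, tensorPow q m f := by
  have h := Measure.map_infinitePi_infinitePi_of_inj (P := fun _ : ℕ => letterLaw q)
    (f := (Fin.val : Fin m → ℕ)) Fin.val_injective
  have h1 : {ω : ℕ → Fin d | p fun j => ω j} = (fun ω (i : Fin m) => ω i) ⁻¹' {f | p f} := rfl
  rw [h1, ← map_measureReal_apply (by fun_prop) (Set.toFinite _).measurableSet, h]
  have h2 : {f | p f} = ((Finset.univ.filter p : Finset (Fin m → Fin d)) : Set _) := by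
    ext; simp
  rw [h2, ← sum_measureReal_singleton]
  refine Finset.sum_congr rfl fun f _ => ?_
  rw [Measure.real, Measure.infinitePi_singleton_of_fintype, ENNReal.toReal_prod]
  simp [tensorPow, letterLaw_singleton, ENNReal.toReal_ofReal (hq.1 _)]

lemma tailMass_anti {q : Fin d → ℝ} (hq : IsProbVec q) (m : ℕ) : Antitone (tailMass q m) := by
  intro x y hxy
  refine Finset.sum_le_sum_of_subset_of_nonneg (fun f hf => ?_)
    fun f _ _ => Finset.prod_nonneg fun j _ => hq.1 _
  simp only [Finset.mem_filter, Finset.mem_univ, true_and] at hf ⊢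
  linarith

/-- Central limit theorem for the information content, on closed sets. -/
lemma eventually_infinitePi_letterLaw_real_lt {q : Fin d → ℝ} (hq : IsProbVec q)
    [IsProbabilityMeasure (letterLaw q)] {F : Set ℝ} (hF : IsClosed F) {r : ℝ}
    (hr : (gaussianReal 0 (entVar q).toNNReal).real F < r) :
    ∀ᶠ m : ℕ in atTop, (Measure.infinitePi fun _ : ℕ => letterLaw q).real
      {ω | (√(m : ℝ))⁻¹ * (surprisal q (fun j : Fin m => ω j) - m * shannonH q) ∈ F} < r := by
  set P := Measure.infinitePi fun _ : ℕ => letterLaw q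
  set X : ℕ → (ℕ → Fin d) → ℝ := fun k ω => -Real.log (q (ω k)) with hX
  have hmX : ∀ k, Measurable (X k) := fun k =>
    (measurable_of_finite fun i => -Real.log (q i)).comp (measurable_pi_apply k)
  have hmap : ∀ k, P.map (fun ω => ω k) = letterLaw q := fun k =>
    Measure.infinitePi_map_eval (fun _ : ℕ => letterLaw q) k
  have hproj : ∀ k, AEMeasurable (fun ω : ℕ → Fin d => ω k) P := fun k =>
    (measurable_pi_apply k).aemeasurable
  have hint : ∀ g : Fin d → ℝ, ∫ ω, g (ω 0) ∂P = ∑ i, q i * g i := by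
    intro g
    rw [← integral_letterLaw hq, ← hmap 0, integral_map (hproj 0)]
    exact (measurable_of_finite g).aestronglyMeasurable
  have hmean : P[X 0] = shannonH q := by
    rw [hint fun i => -Real.log (q i)]
    simp [shannonH]
  have hvar : Var[X 0; P] = entVar q := by
    rw [variance_eq_integral (hmX 0).aemeasurable, hmean,
      hint fun i => (-Real.log (q i) - shannonH q) ^ 2]
    rfl
  have hident : ∀ k, IdentDistrib (X k) (X 0) P P := by
    intro k
    refine IdentDistrib.comp (u := fun i => -Real.log (q i)) (f := fun ω : ℕ → Fin d => ω k)
      (g := fun ω : ℕ → Fin d => ω 0) ⟨hproj k, hproj 0, ?_⟩ (measurable_of_finite _)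
    rw [hmap, hmap]
  have hindep : iIndepFun X P :=
    iIndepFun_infinitePi (X := fun _ i => -Real.log (q i)) fun _ => measurable_of_finite _
  have hLp : MemLp (X 0) 2 P := by
    have h : MemLp (fun i => -Real.log (q i)) 2 (P.map fun ω => ω 0) := by
      rw [hmap 0]
      exact MemLp.of_discrete
    exact h.comp_of_map (hproj 0)
  have hclt := tendstoInDistribution_inv_sqrt_mul_sum_sub (X := X) (P := P) (Y := id)
    (P' := gaussianReal 0 Var[X 0; P].toNNReal) HasLaw.id hLp hindep hident
  have hlim := ProbabilityMeasure.limsup_measure_closed_le_of_tendsto hclt.tendsto hF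
  simp only [ProbabilityMeasure.coe_mk, Measure.map_id, hvar] at hlim
  have hr0 : 0 < r := measureReal_nonneg.trans_lt hr
  have hlt : gaussianReal 0 (entVar q).toNNReal F < ENNReal.ofReal r :=
    (ENNReal.lt_ofReal_iff_toReal_lt (measure_ne_top _ _)).2 hr
  filter_upwards [eventually_lt_of_limsup_lt (hlim.trans_lt hlt)] with m hm
  rw [Measure.map_apply_of_aemeasurable (hclt.forall_aemeasurable m) hF.measurableSet] at hm
  refine (ENNReal.lt_ofReal_iff_toReal_lt (measure_ne_top _ _)).1 ?_
  convert hm using 3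
  ext ω
  rw [hmean]
  simp [surprisal, hX, Finset.sum_range]

lemma eventually_one_sub_le_tailMass {q : Fin d → ℝ} (hq : IsProbVec q) {ε δ : ℝ}
    (hε : ε ∈ Set.Ioo (0 : ℝ) 1) (hδ : 0 < δ) :
    ∀ᶠ m : ℕ in atTop, 1 - ε ≤
      tailMass q m (m * shannonH q + √(m : ℝ) * (√(entVar q) * PhiInv ε - δ)) := by
  have := isProbabilityMeasure_letterLaw hq
  have hV : 0 ≤ entVar q := Finset.sum_nonneg fun i _ => mul_nonneg (hq.1 i) (sq_nonneg _)
  have hG := gaussianReal_real_Iic_lt (V := (entVar q).toNNReal) hε hδ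
  rw [Real.coe_toNNReal _ hV] at hG
  filter_upwards [eventually_infinitePi_letterLaw_real_lt hq isClosed_Iic hG,
    eventually_gt_atTop 0] with m hm hm0
  have hs : 0 < √(m : ℝ) := Real.sqrt_pos.2 (by exact_mod_cast hm0)
  classical
  rw [tailMass, ← infinitePi_letterLaw_real hq]
  set P := Measure.infinitePi fun _ : ℕ => letterLaw q
  set A := {ω : ℕ → Fin d | (√(m : ℝ))⁻¹ * (surprisal q (fun j : Fin m => ω j) - m * shannonH q) ∈
    Set.Iic (√(entVar q) * PhiInv ε - δ)}
  set B := {ω : ℕ → Fin d | m * shannonH q + √(m : ℝ) * (√(entVar q) * PhiInv ε - δ) ≤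
    surprisal q fun j : Fin m => ω j}
  have hAB : Set.univ ⊆ A ∪ B := by
    intro ω _
    by_cases h : ω ∈ B
    · exact Or.inr h
    · left
      simp only [B, Set.mem_ofPred_eq, not_le] at h
      simp only [A, Set.mem_ofPred_eq, Set.mem_Iic]
      rw [inv_mul_le_iff₀ hs]
      linarith
  have h1 := (measureReal_mono (μ := P) hAB).trans (measureReal_union_le A B)
  rw [probReal_univ] at h1
  linarith

lemma exists_tailMass_le {q : Fin d → ℝ} (hq : IsProbVec q) {ε δ : ℝ}
    (hε : ε ∈ Set.Ioo (0 : ℝ) 1) (hδ : 0 < δ) :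
    ∃ r < 1 - ε, ∀ᶠ m : ℕ in atTop,
      tailMass q m (m * shannonH q + √(m : ℝ) * (√(entVar q) * PhiInv ε + δ)) ≤ r := by
  have := isProbabilityMeasure_letterLaw hq
  have hV : 0 ≤ entVar q := Finset.sum_nonneg fun i _ => mul_nonneg (hq.1 i) (sq_nonneg _)
  have hG := gaussianReal_real_Ici_lt (V := (entVar q).toNNReal) hε hδ
  rw [Real.coe_toNNReal _ hV] at hG
  obtain ⟨r, hr, hr1⟩ := exists_between hG
  refine ⟨r, hr1, ?_⟩
  filter_upwards [eventually_infinitePi_letterLaw_real_lt hq isClosed_Ici hr,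
    eventually_gt_atTop 0] with m hm hm0
  have hs : 0 < √(m : ℝ) := Real.sqrt_pos.2 (by exact_mod_cast hm0)
  classical
  rw [tailMass, ← infinitePi_letterLaw_real hq]
  refine le_trans (measureReal_mono fun ω hω => ?_) hm.le
  simp only [Set.mem_ofPred_eq, Set.mem_Ici] at hω ⊢
  rw [le_inv_mul_iff₀ hs]
  linarith

end Tail

section Formation

variable {d : ℕ}

lemma tensorPow_nonneg {a : Fin d → ℝ} (ha : ∀ i, 0 ≤ a i) {n : ℕ} (f : Fin n → Fin d) :
    0 ≤ tensorPow a n f :=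
  Finset.prod_nonneg fun _ _ => ha _

lemma isProbVec_tensorPow {a : Fin d → ℝ} (ha : IsProbVec a) (n : ℕ) :
    IsProbVec (tensorPow a n) := by
  refine ⟨tensorPow_nonneg ha.1, ?_⟩
  have h := (Fintype.sum_pow a n).symm
  rw [ha.2, one_pow] at h
  exact h

lemma tensorPow_const (c : ℝ) (n : ℕ) (f : Fin n → Fin d) :
    tensorPow (fun _ => c) n f = c ^ n := by
  simp [tensorPow]

lemma IsProbVec.mul {ι κ : Type*} [Fintype ι] [Fintype κ] {a : ι → ℝ} {b : κ → ℝ}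
    (ha : IsProbVec a) (hb : IsProbVec b) : IsProbVec fun x : ι × κ => a x.1 * b x.2 := by
  refine ⟨fun x => mul_nonneg (ha.1 _) (hb.1 _), ?_⟩
  rw [Fintype.sum_prod_type]
  simp_rw [← Finset.mul_sum, hb.2, mul_one, ha.2]

lemma IsProbVec.dim_pos {a : Fin d → ℝ} (ha : IsProbVec a) : 0 < d := by
  rcases Nat.eq_zero_or_pos d with rfl | h
  · simpa using ha.2
  · exact h

lemma isProbVec_uniform (hd : 0 < d) : IsProbVec fun _ : Fin d => (d : ℝ)⁻¹ := by
  refine ⟨fun _ => by positivity, ?_⟩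
  have : (d : ℝ) ≠ 0 := by positivity
  simp [this]

lemma IsFlat.eq_zero_or_eq {p : Fin d → ℝ} (hp : IsProbVec p) (hf : IsFlat p) (i : Fin d) :
    p i = 0 ∨ p i = Real.exp (-shannonH p) := by
  by_cases hi : p i = 0
  · exact Or.inl hi
  · right
    have h : ∀ j, p j * Real.log (p j) = p j * Real.log (p i) := by
      intro j
      by_cases hj : p j = 0
      · simp [hj]
      · rw [hf j i hj hi]
    have h0 : 0 < p i := lt_of_le_of_ne (hp.1 i) (Ne.symm hi)
    rw [shannonH, neg_neg, Finset.sum_congr rfl fun j _ => h j, ← Finset.sum_mul, hp.2, one_mul,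
      Real.exp_log h0]

lemma tensorPow_eq_zero_or_eq {p : Fin d → ℝ} (hp : IsProbVec p) (hf : IsFlat p) (n : ℕ)
    (f : Fin n → Fin d) :
    tensorPow p n f = 0 ∨ tensorPow p n f = Real.exp (-(n * shannonH p)) := by
  by_cases h : ∃ j, p (f j) = 0
  · obtain ⟨j, hj⟩ := h
    exact Or.inl (Finset.prod_eq_zero (Finset.mem_univ j) hj)
  · push Not at h
    right
    rw [tensorPow, Finset.prod_congr rfl fun j _ => (hf.eq_zero_or_eq hp (f j)).resolve_left (h j)]
    simp [← Real.exp_nat_mul]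

lemma tensorPow_le_exp {q : Fin d → ℝ} (hq : ∀ i, 0 ≤ q i) {m : ℕ} (f : Fin m → Fin d) :
    tensorPow q m f ≤ Real.exp (-surprisal q f) := by
  rw [surprisal, Finset.sum_neg_distrib, neg_neg, Real.exp_sum]
  exact Finset.prod_le_prod (fun j _ => hq _) fun j _ => Real.le_exp_log _

lemma tensorPow_eq_exp {q : Fin d → ℝ} (hq : ∀ i, 0 ≤ q i) {m : ℕ} {f : Fin m → Fin d}
    (hf : tensorPow q m f ≠ 0) : tensorPow q m f = Real.exp (-surprisal q f) := by
  rw [surprisal, Finset.sum_neg_distrib, neg_neg, Real.exp_sum]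
  refine Finset.prod_congr rfl fun j _ => (Real.exp_log ?_).symm
  exact lt_of_le_of_ne (hq _) (Ne.symm (Finset.prod_ne_zero_iff.1 hf j (Finset.mem_univ j)))

/-- Formation of `m` copies of `q` from `n` copies of `p` within infidelity `ε`, with uniform
vectors as free ancillas. -/
def FormationPossible (ε : ℝ) (p q : Fin d → ℝ) (n m : ℕ) : Prop :=
  PostMaj ε
    (fun fg : (Fin n → Fin d) × (Fin m → Fin d) =>
      tensorPow p n fg.1 * tensorPow (fun _ : Fin d => (d : ℝ)⁻¹) m fg.2)
    (fun fg : (Fin m → Fin d) × (Fin n → Fin d) =>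
      tensorPow q m fg.1 * tensorPow (fun _ : Fin d => (d : ℝ)⁻¹) n fg.2)

lemma inv_pow_eq_exp (hd : 0 < d) (n : ℕ) : ((d : ℝ)⁻¹) ^ n = Real.exp (-(n * Real.log d)) := by
  rw [Real.exp_neg, Real.exp_nat_mul, Real.exp_log (by exact_mod_cast hd), inv_pow]

lemma sum_filter_fst {α β : Type*} [Fintype α] [Fintype β] (P : α → Prop) [DecidablePred P]
    (a : α → ℝ) {b : β → ℝ} (hb : ∑ y, b y = 1) :
    ∑ x : α × β with P x.1, a x.1 * b x.2 = ∑ x with P x, a x := by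
  rw [Finset.sum_filter, Fintype.sum_prod_type, Finset.sum_filter]
  refine Finset.sum_congr rfl fun x _ => ?_
  split_ifs
  · simp only [← Finset.mul_sum, hb, mul_one]
  · simp

lemma formationPossible_of_tailMass {p q : Fin d → ℝ} (hp : IsProbVec p) (hq : IsProbVec q)
    (hpf : IsFlat p) {ε : ℝ} (hε : ε < 1) {n m : ℕ} {x : ℝ} (hx : 1 - ε ≤ tailMass q m x)
    (hxm : m * Real.log d - n * relD p - Real.log (1 - ε) ≤ x) :
    FormationPossible ε p q n m := by
  have hd := hp.dim_pos
  have hu := isProbVec_uniform hd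
  have hQ := (isProbVec_tensorPow hq m).mul (isProbVec_tensorPow hu n)
  have hP := (isProbVec_tensorPow hp n).mul (isProbVec_tensorPow hu m)
  have hε' : 0 < 1 - ε := by linarith
  obtain ⟨Qt, hQt, hc, hF⟩ := exists_probVec_of_mass hQ
    (Finset.univ.filter fun fg : (Fin m → Fin d) × (Fin n → Fin d) => x ≤ surprisal q fg.1) hε'
    (by rw [sum_filter_fst (fun f => x ≤ surprisal q f) (tensorPow q m)
          (isProbVec_tensorPow hu n).2]; exact hx)
    (c := Real.exp (-(n * shannonH p)) * Real.exp (-(m * Real.log d))) (by positivity)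
    (fun fg hfg => by
      have hx' : x ≤ surprisal q fg.1 := by simpa using hfg
      have h1 := tensorPow_le_exp hq.1 fg.1
      rw [tensorPow_const, inv_pow_eq_exp hd]
      calc tensorPow q m fg.1 * Real.exp (-(n * Real.log d))
          ≤ Real.exp (-surprisal q fg.1) * Real.exp (-(n * Real.log d)) := by gcongr
        _ ≤ Real.exp (-(n * shannonH p)) * Real.exp (-(m * Real.log d)) *
              Real.exp (Real.log (1 - ε)) := by
            simp only [← Real.exp_add]
            refine Real.exp_le_exp.2 ?_
            simp only [relD] at hxm
            linarith
        _ = _ := by rw [Real.exp_log hε'])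
  refine ⟨Qt, hQt, majorises_of_flat hP (fun fg => ?_) hQt hc, ?_⟩
  · rw [tensorPow_const, inv_pow_eq_exp hd]
    rcases tensorPow_eq_zero_or_eq hp hpf n fg.1 with h | h <;> simp [h]
  · unfold infid
    linarith

lemma FormationPossible.le_tailMass {p q : Fin d → ℝ} (hp : IsProbVec p) (hq : IsProbVec q)
    (hpf : IsFlat p) {ε : ℝ} {n m : ℕ} (h : FormationPossible ε p q n m) (s : ℝ) :
    1 - ε ≤ (√(tailMass q m (m * Real.log d - n * relD p - s)) + Real.exp (-s / 2)) ^ 2 := by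
  have hd := hp.dim_pos
  have hu := isProbVec_uniform hd
  have hQ := (isProbVec_tensorPow hq m).mul (isProbVec_tensorPow hu n)
  obtain ⟨Qt, hQt, hmaj, hF⟩ := h
  have hc := hmaj.le_of_forall_le
    (c := Real.exp (-(n * shannonH p)) * Real.exp (-(m * Real.log d))) (by positivity) fun fg => by
      rw [tensorPow_const, inv_pow_eq_exp hd]
      gcongr
      rcases tensorPow_eq_zero_or_eq hp hpf n fg.1 with h | h
      · rw [h]; positivity
      · exact h.le
  have h1 := fidelity_le_of_le hQ hQt hc s
  unfold infid at hF
  refine (by linarith : 1 - ε ≤ _).trans (h1.trans ?_)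
  gcongr
  rw [tailMass, ← sum_filter_fst _ (tensorPow q m) (isProbVec_tensorPow hu n).2,
    Finset.sum_filter, Finset.sum_filter]
  refine Finset.sum_le_sum fun fg _ => ?_
  by_cases h0 : tensorPow q m fg.1 = 0
  · simp [h0]
  · by_cases h2 : m * Real.log d - n * relD p - s ≤ surprisal q fg.1
    · rw [if_pos h2]
      split_ifs
      · rfl
      · exact hQ.1 fg
    · rw [if_neg h2, if_neg]
      rw [tensorPow_const, inv_pow_eq_exp hd, tensorPow_eq_exp hq.1 h0]
      simp only [← Real.exp_add, Real.exp_le_exp]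
      simp only [relD] at h2
      intro h3
      apply h2
      linarith

lemma mul_log_eq (q : Fin d → ℝ) (m : ℝ) : m * Real.log d = m * relD q + m * shannonH q := by
  simp only [relD]
  ring

lemma eventually_mul_sqrt_ge {δ : ℝ} (hδ : 0 < δ) (C : ℝ) :
    ∀ᶠ m : ℕ in atTop, C ≤ √(m : ℝ) * δ :=
  ((Real.tendsto_sqrt_atTop.comp tendsto_natCast_atTop_atTop).atTop_mul_const hδ).eventually_ge_atTop
    C

lemma eventually_formationPossible {p q : Fin d → ℝ} (hp : IsProbVec p) (hq : IsProbVec q)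
    (hpf : IsFlat p) {ε δ : ℝ} (hε : ε ∈ Set.Ioo (0 : ℝ) 1) (hδ : 0 < δ) :
    ∀ᶠ m : ℕ in atTop, ∀ n : ℕ,
      m * relD q - n * relD p ≤ √(m : ℝ) * (√(entVar q) * PhiInv ε - δ) →
        FormationPossible ε p q n m := by
  filter_upwards [eventually_one_sub_le_tailMass hq hε (half_pos hδ),
    eventually_mul_sqrt_ge (half_pos hδ) (-Real.log (1 - ε))] with m h1 h2 n hn
  refine formationPossible_of_tailMass hp hq hpf hε.2 h1 ?_
  rw [mul_log_eq q]
  linarith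

lemma eventually_not_formationPossible {p q : Fin d → ℝ} (hp : IsProbVec p) (hq : IsProbVec q)
    (hpf : IsFlat p) {ε δ : ℝ} (hε : ε ∈ Set.Ioo (0 : ℝ) 1) (hδ : 0 < δ) :
    ∀ᶠ m : ℕ in atTop, ∀ n : ℕ,
      √(m : ℝ) * (√(entVar q) * PhiInv ε + δ) ≤ m * relD q - n * relD p →
        ¬ FormationPossible ε p q n m := by
  obtain ⟨r, hr, hr'⟩ := exists_tailMass_le hq hε (half_pos hδ)
  obtain ⟨s, hs⟩ : ∃ s : ℝ, (√r + Real.exp (-s / 2)) ^ 2 < 1 - ε := by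
    have h : Tendsto (fun s : ℝ => (√r + Real.exp (-s / 2)) ^ 2) atTop (nhds ((√r + 0) ^ 2)) := by
      refine (tendsto_const_nhds.add (Real.tendsto_exp_atBot.comp ?_)).pow 2
      exact (tendsto_neg_atTop_atBot).atBot_div_const two_pos
    refine (h.eventually_lt_const ?_).exists
    rw [add_zero]
    rcases le_total 0 r with h0 | h0
    · rwa [Real.sq_sqrt h0]
    · rw [Real.sqrt_eq_zero_of_nonpos h0]
      simpa using hε.2
  filter_upwards [hr', eventually_mul_sqrt_ge (half_pos hδ) s] with m h1 h2 n hn hform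
  have h3 := hform.le_tailMass hp hq hpf s
  refine absurd (h3.trans ?_) (not_le.2 hs)
  gcongr
  refine (tailMass_anti hq m ?_).trans h1
  rw [mul_log_eq q]
  linarith

end Formation

section Asymptotics

lemma tendsto_sSup_of_quadratic {a b z : ℝ} (ha : 0 < a) (hb : 0 < b) {S : ℕ → Set ℕ}
    (hlow : ∀ δ > 0, ∀ᶠ m : ℕ in atTop, ∀ n : ℕ, m * b - n * a ≤ √(m : ℝ) * (z - δ) → m ∈ S n)
    (hup : ∀ δ > 0, ∀ᶠ m : ℕ in atTop, ∀ n : ℕ, √(m : ℝ) * (z + δ) ≤ m * b - n * a → m ∉ S n) :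
    Tendsto (fun n : ℕ => (((sSup (S n) : ℕ) : ℝ) - n * (a / b)) / √(n : ℝ)) atTop
      (nhds (√(a / b) * z / b)) := by
  have hab : 0 < a / b := div_pos ha hb
  have hw : 0 < √(a / b) := Real.sqrt_pos.2 hab
  have hsqrt : Tendsto (fun n : ℕ => √(n : ℝ)) atTop atTop :=
    Real.tendsto_sqrt_atTop.comp tendsto_natCast_atTop_atTop
  have hratio : ∀ K : ℝ, Tendsto (fun n : ℕ => √(a / b + K / √(n : ℝ))) atTop
      (nhds √(a / b)) := by
    intro K
    have h := (tendsto_const_nhds (x := a / b)).add (hsqrt.const_div_atTop K)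
    rw [add_zero] at h
    exact h.sqrt
  have hT : ∀ K : ℝ, ∀ n : ℕ,
      (n : ℝ) * (a / b) + K * √(n : ℝ) = n * (a / b + K / √(n : ℝ)) := by
    intro K n
    rw [mul_add, mul_div_left_comm (n : ℝ) K, Real.div_sqrt]
  have hTtop : ∀ K : ℝ, Tendsto (fun n : ℕ => (n : ℝ) * (a / b) + K * √(n : ℝ)) atTop atTop := by
    intro K
    have h := (tendsto_const_nhds (x := a / b)).add (hsqrt.const_div_atTop K)
    rw [add_zero] at h
    exact (tendsto_natCast_atTop_atTop.atTop_mul_pos hab h).congr fun n => (hT K n).symm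
  have hmono : ∀ c w w' : ℝ, 0 ≤ w → w ≤ w' → c ≤ b * w' →
      b * w ^ 2 - c * w ≤ b * w' ^ 2 - c * w' := by
    intro c w w' h0 h1 h2
    nlinarith [mul_nonneg (sub_nonneg.2 h1) (sub_nonneg.2 h2),
      mul_nonneg (sub_nonneg.2 h1) (mul_nonneg hb.le h0)]
  set K0 := √(a / b) * z / b with hK0
  have hK0b : b * K0 = √(a / b) * z := by rw [hK0]; field_simp
  rw [Metric.tendsto_nhds]
  intro η hη
  set δ := b * (η / 2) / (2 * √(a / b)) with hδ
  have hδ0 : 0 < δ := by positivity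
  have hδw : √(a / b) * δ = b * (η / 2) / 2 := by rw [hδ]; field_simp
  have hupper : ∀ᶠ n : ℕ in atTop, ∀ m ∈ S n,
      (m : ℝ) ≤ n * (a / b) + (K0 + η / 2) * √(n : ℝ) := by
    obtain ⟨M, hM⟩ := eventually_atTop.1 (hup δ hδ0)
    have hlim := ((hratio (K0 + η / 2)).mul_const (z + δ)).eventually_le_const
      (show √(a / b) * (z + δ) < b * (K0 + η / 2) by
        rw [mul_add, mul_add, hδw, hK0b]; linarith [mul_pos hb hη])
    have hTsq := (Real.tendsto_sqrt_atTop.comp (hTtop (K0 + η / 2))).const_mul_atTop hb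
    filter_upwards [hlim, (hTtop (K0 + η / 2)).eventually_ge_atTop (M : ℝ),
      hTsq.eventually_ge_atTop (z + δ)] with n h1 h2 h3 m hm
    by_contra! hlt
    refine hM m (by exact_mod_cast h2.trans hlt.le) n ?_ hm
    set T := (n : ℝ) * (a / b) + (K0 + η / 2) * √(n : ℝ) with hTdef
    have hT0 : 0 ≤ T := (Nat.cast_nonneg M).trans h2
    have hle : √T ≤ √(m : ℝ) := Real.sqrt_le_sqrt hlt.le
    have h4 := hmono (z + δ) (√T) (√(m : ℝ)) (Real.sqrt_nonneg _) hle
      (h3.trans (mul_le_mul_of_nonneg_left hle hb.le))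
    rw [Real.sq_sqrt hT0, Real.sq_sqrt (Nat.cast_nonneg m)] at h4
    have h5 : √T = √(n : ℝ) * √(a / b + (K0 + η / 2) / √(n : ℝ)) := by
      rw [hTdef, hT _ n, Real.sqrt_mul (Nat.cast_nonneg n)]
    have h6 : (z + δ) * √T ≤ √(n : ℝ) * (b * (K0 + η / 2)) := by
      rw [h5]
      nlinarith [mul_le_mul_of_nonneg_left h1 (Real.sqrt_nonneg (n : ℝ))]
    have h7 : b * T = n * a + √(n : ℝ) * (b * (K0 + η / 2)) := by
      rw [hTdef]; field_simp
    nlinarith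
  have hlower : ∀ᶠ n : ℕ in atTop, ∃ m ∈ S n,
      (n : ℝ) * (a / b) + (K0 - η / 2) * √(n : ℝ) - 1 ≤ m := by
    obtain ⟨M, hM⟩ := eventually_atTop.1 (hlow δ hδ0)
    have hlim := ((hratio (K0 - η / 2)).mul_const (z - δ)).eventually_const_le
      (show b * (K0 - η / 2) < √(a / b) * (z - δ) by
        rw [mul_sub, mul_sub, hδw, hK0b]; linarith [mul_pos hb hη])
    have hTsq := (Real.tendsto_sqrt_atTop.comp (hTtop (K0 - η / 2))).const_mul_atTop hb
    filter_upwards [hlim, (hTtop (K0 - η / 2)).eventually_ge_atTop (M : ℝ),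
      hTsq.eventually_ge_atTop (z - δ)] with n h1 h2 h3
    set T := (n : ℝ) * (a / b) + (K0 - η / 2) * √(n : ℝ) with hTdef
    have hT0 : 0 ≤ T := (Nat.cast_nonneg M).trans h2
    refine ⟨⌊T⌋₊, hM _ (Nat.le_floor h2) n ?_, (Nat.sub_one_lt_floor T).le⟩
    set m := ⌊T⌋₊
    have hlt : (m : ℝ) ≤ T := Nat.floor_le hT0
    have hle : √(m : ℝ) ≤ √T := Real.sqrt_le_sqrt hlt
    have h4 := hmono (z - δ) (√(m : ℝ)) (√T) (Real.sqrt_nonneg _) hle h3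
    rw [Real.sq_sqrt hT0, Real.sq_sqrt (Nat.cast_nonneg m)] at h4
    have h5 : √T = √(n : ℝ) * √(a / b + (K0 - η / 2) / √(n : ℝ)) := by
      rw [hTdef, hT _ n, Real.sqrt_mul (Nat.cast_nonneg n)]
    have h6 : √(n : ℝ) * (b * (K0 - η / 2)) ≤ (z - δ) * √T := by
      rw [h5]
      nlinarith [mul_le_mul_of_nonneg_left h1 (Real.sqrt_nonneg (n : ℝ))]
    have h7 : b * T = n * a + √(n : ℝ) * (b * (K0 - η / 2)) := by
      rw [hTdef]; field_simp
    nlinarith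
  filter_upwards [eventually_gt_atTop 0, hupper, hlower,
    eventually_mul_sqrt_ge (show 0 < η / 4 by positivity) 1] with n hn h1 ⟨m, hmS, hm⟩ h3
  have h0 : 0 < √(n : ℝ) := Real.sqrt_pos.2 (by exact_mod_cast hn)
  have hbdd : BddAbove (S n) :=
    ⟨_, fun k hk => Nat.le_floor (h1 k hk)⟩
  have h4 : ((sSup (S n) : ℕ) : ℝ) ≤ n * (a / b) + (K0 + η / 2) * √(n : ℝ) :=
    h1 _ (Nat.sSup_mem ⟨m, hmS⟩ hbdd)
  have h5 : (m : ℝ) ≤ ((sSup (S n) : ℕ) : ℝ) := by exact_mod_cast le_csSup hbdd hmS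
  rw [Real.dist_eq, abs_lt, lt_sub_iff_add_lt, sub_lt_iff_lt_add, lt_div_iff₀ h0, div_lt_iff₀ h0]
  constructor <;> nlinarith [mul_pos h0 hη]

end Asymptotics

/-- second-order expansion for formation: for flat `p` with
`D(p) > 0`, `D(q) > 0` and `ε ∈ (0,1)`,
`R*₀(n,ε) = (1/D(q))[D(p) + √(D(p)V(q)/(D(q)n)) Φ⁻¹(ε)] + o(1/√n)`. -/
theorem second_order_formation
    {d : ℕ} (p q : Fin d → ℝ) (hp : IsProbVec p) (hq : IsProbVec q)
    (hpf : IsFlat p) (hDp : 0 < relD p) (hDq : 0 < relD q)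
    (ε : ℝ) (hε : ε ∈ Set.Ioo (0:ℝ) 1) :
    Filter.Tendsto (fun n : ℕ => Real.sqrt n *
      (((sSup {m : ℕ | PostMaj ε
          (fun fg : (Fin n → Fin d) × (Fin m → Fin d) =>
            tensorPow p n fg.1 * tensorPow (fun _ : Fin d => (d : ℝ)⁻¹) m fg.2)
          (fun fg : (Fin m → Fin d) × (Fin n → Fin d) =>
            tensorPow q m fg.1 * tensorPow (fun _ : Fin d => (d : ℝ)⁻¹) n fg.2)} : ℕ) : ℝ)
          / n
        - (1 / relD q) * (relD p
            + Real.sqrt (relD p * entVar q / (relD q * n)) * PhiInv ε)))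
      Filter.atTop (nhds 0) := by
  have hV : 0 ≤ entVar q := Finset.sum_nonneg fun i _ => mul_nonneg (hq.1 i) (sq_nonneg _)
  have hlim := tendsto_sSup_of_quadratic (S := fun n => {m | FormationPossible ε p q n m}) hDp hDq
    (fun δ hδ => eventually_formationPossible hp hq hpf hε hδ)
    (fun δ hδ => eventually_not_formationPossible hp hq hpf hε hδ)
  refine (tendsto_sub_nhds_zero_iff.2 hlim).congr' ?_
  filter_upwards [eventually_gt_atTop 0] with n hn
  have h0 : 0 < √(n : ℝ) := Real.sqrt_pos.2 (by exact_mod_cast hn)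
  have hn0 : (n : ℝ) = √(n : ℝ) * √(n : ℝ) := (Real.mul_self_sqrt (Nat.cast_nonneg n)).symm
  have hsq : √(relD p * entVar q / (relD q * n)) =
      √(relD p / relD q) * √(entVar q) / √(n : ℝ) := by
    rw [← Real.sqrt_mul (div_nonneg hDp.le hDq.le), ← Real.sqrt_div (by positivity)]
    congr 1
    field_simp
  rw [hsq]
  unfold FormationPossible
  set A : ℕ := sSup _
  generalize √(n : ℝ) = w at h0 hn0 ⊢
  rw [hn0]
  field_simp
  ring
end
end

section
/- Existence of a nearby majorising vector: let a ∈ ℝ^d and b ∈ ℝ^{d'} be vectors with nonnegative entries such that Σ_i a_i = Σ_j b_j. Then there exists a vector ã ∈ ℝ^d with nonnegative entries such that Σ_i ã_i = Σ_i a_i, ã majorises b, and ‖ã − a‖_∞ ≤ ‖b‖_∞ (i.e. max_i |ã_i − a_i| ≤ max_j b_j). -/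
open Finset Filter

noncomputable section

/-- Collecting the nonzero entries of `q` into blocks gives a vector that majorises `q`. -/
theorem majorises_sum_blocks {ι κ : Type*} [Fintype ι] [Fintype κ] (q : κ → ℝ)
    (hq : ∀ j, 0 ≤ q j) (F : ι → Finset κ) (hF : ∀ j, q j ≠ 0 → ∃ i, j ∈ F i) :
    Majorises (fun i => ∑ j ∈ F i, q j) q := by
  classical
  intro k
  refine Finset.sup'_le _ _ fun T hT => ?_
  rcases isEmpty_or_nonempty ι with hι | hι
  · have hq_zero (j : κ) : q j = 0 := by_contra fun h => isEmptyElim (hF j h).choose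
    rw [sum_eq_zero fun j _ => hq_zero j]
    exact Finset.le_sup' (fun s : Finset ι => ∑ i ∈ s, ∑ j ∈ F i, q j) (b := ∅) (by simp)
  choose! g hg using hF
  have hcard : ((T.filter (q · ≠ 0)).image g).card ≤ k :=
    card_image_le.trans ((card_filter_le _ _).trans (by simpa using hT))
  refine le_trans ?_ (Finset.le_sup' (fun s : Finset ι => ∑ i ∈ s, ∑ j ∈ F i, q j)
    (b := (T.filter (q · ≠ 0)).image g) (by simpa using hcard))
  rw [← Finset.sum_filter_ne_zero, ← Finset.sum_fiberwise_of_maps_to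
    (fun j hj => mem_image_of_mem g hj)]
  refine Finset.sum_le_sum fun i _ => Finset.sum_le_sum_of_subset_of_nonneg ?_ fun j _ _ => hq j
  intro j hj
  simp only [mem_filter] at hj
  exact hj.2 ▸ hg j hj.1.2

/-- The sum of those among the first `n` terms of `u` whose partial sum is at most `x`; for
nonnegative `u` this is the largest partial sum not exceeding `x`. -/
def partialSumFloor (u : ℕ → ℝ) (n : ℕ) (x : ℝ) : ℝ :=
  ∑ j ∈ range n with ∑ l ∈ range (j + 1), u l ≤ x, u j

theorem partialSumFloor_eq {u : ℕ → ℝ} (hu : ∀ j, 0 ≤ u j) {n : ℕ} {x : ℝ}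
    (hx : ∑ l ∈ range n, u l ≤ x) : partialSumFloor u n x = ∑ l ∈ range n, u l := by
  unfold partialSumFloor
  rw [Finset.filter_true_of_mem]
  intro j hj
  refine le_trans (Finset.sum_le_sum_of_subset_of_nonneg ?_ fun l _ _ => hu l) hx
  simpa using hj

theorem partialSumFloor_succ_of_lt {u : ℕ → ℝ} {n : ℕ} {x : ℝ}
    (hx : x < ∑ l ∈ range (n + 1), u l) :
    partialSumFloor u (n + 1) x = partialSumFloor u n x := by
  unfold partialSumFloor
  rw [range_add_one (n := n), filter_insert, if_neg hx.not_ge]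

theorem partialSumFloor_le {u : ℕ → ℝ} (hu : ∀ j, 0 ≤ u j) {x : ℝ} (hx : 0 ≤ x) (n : ℕ) :
    partialSumFloor u n x ≤ x := by
  induction n with
  | zero => simpa [partialSumFloor] using hx
  | succ n ih =>
    rcases le_or_gt (∑ l ∈ range (n + 1), u l) x with h | h
    · rwa [partialSumFloor_eq hu h]
    · rwa [partialSumFloor_succ_of_lt h]

theorem sub_le_partialSumFloor {u : ℕ → ℝ} (hu : ∀ j, 0 ≤ u j) {M : ℝ} (hM : ∀ j, u j ≤ M)
    {x : ℝ} {n : ℕ} (hx : x ≤ ∑ l ∈ range n, u l) : x - M ≤ partialSumFloor u n x := by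
  have hM0 : 0 ≤ M := (hu 0).trans (hM 0)
  induction n with
  | zero => simp [partialSumFloor] at hx ⊢; linarith
  | succ n ih =>
    rcases hx.eq_or_lt with h | h
    · rw [partialSumFloor_eq hu h.ge]; linarith
    · rw [partialSumFloor_succ_of_lt h]
      rcases le_or_gt x (∑ l ∈ range n, u l) with h' | h'
      · exact ih h'
      · rw [partialSumFloor_eq hu h'.le]
        rw [sum_range_succ] at h
        linarith [hM n]

theorem partialSumFloor_sub (u : ℕ → ℝ) (n : ℕ) {x y : ℝ} (hxy : x ≤ y) :
    partialSumFloor u n y - partialSumFloor u n x =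
      ∑ j ∈ univ.filter fun j : Fin n =>
        x < ∑ l ∈ range (j + 1), u l ∧ ∑ l ∈ range (j + 1), u l ≤ y, u j := by
  unfold partialSumFloor
  simp only [sum_filter]
  rw [← sum_sub_distrib, Finset.sum_range]
  refine sum_congr rfl fun j _ => ?_
  split_ifs <;> first | (exfalso; grind) | simp

/-- A sequence that starts below `y` and ends at or above it crosses `y` at some step. -/
theorem exists_lt_and_le_succ {A : ℕ → ℝ} {y : ℝ} {d : ℕ} (h0 : A 0 < y) (hd : y ≤ A d) :
    ∃ i : Fin d, A i < y ∧ y ≤ A (i + 1) := by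
  induction d with
  | zero => exact absurd hd h0.not_ge
  | succ d ih =>
    rcases le_or_gt y (A d) with h | h
    · obtain ⟨i, hi⟩ := ih h
      exact ⟨i.castSucc, hi⟩
    · exact ⟨Fin.last d, h, hd⟩

/-- Extension of a finite vector by zeros. -/
def zeroExtend {n : ℕ} (v : Fin n → ℝ) (k : ℕ) : ℝ :=
  if h : k < n then v ⟨k, h⟩ else 0

@[simp] theorem zeroExtend_coe {n : ℕ} (v : Fin n → ℝ) (i : Fin n) : zeroExtend v i = v i := by
  simp [zeroExtend]

theorem zeroExtend_nonneg {n : ℕ} {v : Fin n → ℝ} (hv : ∀ i, 0 ≤ v i) (k : ℕ) :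
    0 ≤ zeroExtend v k := by
  unfold zeroExtend
  split_ifs
  exacts [hv _, le_rfl]

theorem zeroExtend_le_iSup {n : ℕ} {v : Fin n → ℝ} (hv : ∀ i, 0 ≤ v i) (k : ℕ) :
    zeroExtend v k ≤ ⨆ i, v i := by
  unfold zeroExtend
  split_ifs
  exacts [le_ciSup (Set.finite_range v).bddAbove _, Real.iSup_nonneg hv]

theorem sum_range_zeroExtend {n : ℕ} (v : Fin n → ℝ) :
    ∑ k ∈ range n, zeroExtend v k = ∑ i, v i := by
  simp [Finset.sum_range]

/-- existence of a nearby majorising vector: for nonnegative vectors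
`a`, `b` with equal total sums, there is a nonnegative `ã` with the same total sum
as `a`, majorising `b`, and with `‖ã - a‖_∞ ≤ ‖b‖_∞`. -/
theorem exists_nearby_majorising
    {d d' : ℕ} (a : Fin d → ℝ) (b : Fin d' → ℝ)
    (ha : ∀ i, 0 ≤ a i) (hb : ∀ j, 0 ≤ b j)
    (hsum : ∑ i, a i = ∑ j, b j) :
    ∃ ta : Fin d → ℝ, (∀ i, 0 ≤ ta i) ∧ (∑ i, ta i = ∑ i, a i) ∧
      Majorises ta b ∧ ∀ i, |ta i - a i| ≤ ⨆ j, b j := by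
  set u := zeroExtend b with hu_def
  have hu : ∀ k, 0 ≤ u k := zeroExtend_nonneg hb
  set A : ℕ → ℝ := fun i => ∑ l ∈ range i, zeroExtend a l with hA
  have hA_mono : Monotone A := fun i j hij =>
    Finset.sum_le_sum_of_subset_of_nonneg (by simpa using hij)
      fun l _ _ => zeroExtend_nonneg ha l
  have hA_zero : A 0 = 0 := by simp [hA]
  have hA_nonneg (i : ℕ) : 0 ≤ A i := hA_zero ▸ hA_mono (Nat.zero_le i)
  have hA_last : A d = ∑ l ∈ range d', u l := by
    rw [hu_def, sum_range_zeroExtend, ← hsum, ← sum_range_zeroExtend a]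
  have hta (i : Fin d) := partialSumFloor_sub u d' (hA_mono (Nat.le_succ i))
  have hfloor (i : ℕ) (hi : i ≤ d) :
      A i - (⨆ j, b j) ≤ partialSumFloor u d' (A i) ∧ partialSumFloor u d' (A i) ≤ A i :=
    ⟨sub_le_partialSumFloor hu (zeroExtend_le_iSup hb) (hA_last ▸ hA_mono hi),
      partialSumFloor_le hu (hA_nonneg i) d'⟩
  refine ⟨fun i => partialSumFloor u d' (A (i + 1)) - partialSumFloor u d' (A i),
    fun i => ?_, ?_, ?_, fun i => ?_⟩
  · refine (sum_nonneg fun j _ => ?_).trans_eq (hta i).symm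
    exact hu j
  · have h_zero : partialSumFloor u d' (A 0) = 0 :=
      le_antisymm (hA_zero ▸ partialSumFloor_le hu (hA_nonneg 0) d')
        (sum_nonneg fun j _ => hu j)
    rw [← Finset.sum_range fun i => partialSumFloor u d' (A (i + 1)) - partialSumFloor u d' (A i),
      Finset.sum_range_sub (fun i => partialSumFloor u d' (A i)), h_zero,
      partialSumFloor_eq hu hA_last.ge, hu_def, sum_range_zeroExtend, hsum, sub_zero]
  · simp only [Nat.succ_eq_add_one, hu_def, zeroExtend_coe] at hta
    simp only [hu_def, hta]
    refine majorises_sum_blocks b hb _ fun j hj => ?_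
    have h_pos : A 0 < ∑ l ∈ range (j + 1), u l := by
      have hbj : 0 < u j := by simpa [hu_def] using (hb j).lt_of_ne' hj
      rw [hA_zero, sum_range_succ]
      exact add_pos_of_nonneg_of_pos (sum_nonneg fun l _ => hu l) hbj
    have h_le : ∑ l ∈ range (j + 1), u l ≤ A d := hA_last ▸
      Finset.sum_le_sum_of_subset_of_nonneg (by simp) fun l _ _ => hu l
    simpa using exists_lt_and_le_succ h_pos h_le
  · have h_step : A (i + 1) = A i + a i := by simp [hA, sum_range_succ]
    have h₁ := hfloor i i.is_lt.le
    have h₂ := hfloor (i + 1) i.is_lt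
    rw [abs_le]
    constructor <;> linarith
end
end

section
/- Ratio lemma: let a and b be probability vectors of dimension d with b_i > 0 for all i and with the ratio a_i/b_i strictly decreasing in i. Then for any probability vector c of dimension d satisfying Σ_{i=1}^{k} a_i ≤ Σ_{i=1}^{k} c_i for every k ∈ {1,…,d}, one has F(c, b) ≤ F(a, b), with equality if and only if c = a. -/
open Finset Filter

noncomputable section

/-- Abel summation bound: if all partial sums of `x` are nonnegative and `w` is monotone and
bounded by `M`, then `∑ w i * x i ≤ M * ∑ x i`. -/
theorem sum_mul_le_of_partial_sums_nonneg {d : ℕ} (w x : Fin d → ℝ) (M : ℝ)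
    (hw : Monotone w) (hM : ∀ i, w i ≤ M)
    (hx : ∀ k ≤ d, 0 ≤ ∑ i ∈ univ.filter (fun i : Fin d => (i : ℕ) < k), x i) :
    ∑ i, w i * x i ≤ M * ∑ i, x i := by
  induction d generalizing M with
  | zero => simp
  | succ n ih =>
    have h := ih (fun i => w i.castSucc) (fun i => x i.castSucc) (w (Fin.last n))
      (fun i j hij => hw (Fin.castSucc_le_castSucc_iff.2 hij)) (fun i => hw (Fin.le_last _))
      (fun k hk => by
        have h1 := hx k (by omega)
        rw [sum_filter, Fin.sum_univ_castSucc] at h1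
        rw [sum_filter]
        simpa [hk.not_gt] using h1)
    have h2 : 0 ≤ ∑ i, x i := by
      have h1 := hx (n + 1) le_rfl
      rwa [filter_true_of_mem fun i _ => i.is_lt] at h1
    have h3 := mul_le_mul_of_nonneg_right (hM (Fin.last n)) h2
    rw [Fin.sum_univ_castSucc (f := fun i => w i * x i)]
    rw [Fin.sum_univ_castSucc] at h3 ⊢
    linarith

/-- The tangent-line expansion of `√(c * b)` around `c = a`, with explicit remainder. -/
theorem sqrt_mul_eq_tangent_sub_sq {a b c : ℝ} (ha : 0 < a) (hb : 0 < b) (hc : 0 ≤ c) :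
    √(c * b) = √(a * b) + √(b / a) / 2 * (c - a) - √(b / a) / 2 * (√c - √a) ^ 2 := by
  rw [Real.sqrt_mul hc, Real.sqrt_mul ha.le, Real.sqrt_div hb.le]
  have hA := (Real.sqrt_pos.2 ha).ne'
  have h1 := Real.sq_sqrt ha.le
  have h2 := Real.sq_sqrt hc
  generalize √a = A at *
  generalize √c = C at *
  subst h1 h2
  field_simp
  ring

/-- If `c` dominates `a` in partial sums and `a` vanishes from index `i` on, then `c i = 0`. -/
theorem eq_zero_of_partial_sums_le {d : ℕ} {a c : Fin d → ℝ} (ha : IsProbVec a)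
    (hc : IsProbVec c) (i : Fin d) (hi : ∀ j, i ≤ j → a j = 0)
    (h : ∑ j ∈ univ.filter (fun j : Fin d => (j : ℕ) < i), a j ≤
      ∑ j ∈ univ.filter (fun j : Fin d => (j : ℕ) < i), c j) : c i = 0 := by
  have h1 : ∑ j ∈ univ.filter (fun j : Fin d => (j : ℕ) < i), a j = 1 := by
    rw [← ha.2]
    exact sum_subset (filter_subset _ _) fun j _ hj => hi j (by simpa using hj)
  have h2 : ∑ j ∈ insert i (univ.filter (fun j : Fin d => (j : ℕ) < i)), c j ≤ 1 := by
    rw [← hc.2]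
    exact sum_le_sum_of_subset_of_nonneg (subset_univ _) fun j _ _ => hc.1 j
  rw [sum_insert (by simp)] at h2
  linarith [hc.1 i]

/-- ratio lemma: if `b` is strictly positive and `a_i/b_i` is
strictly decreasing, then any probability vector `c` whose partial sums dominate
those of `a` satisfies `F(c,b) ≤ F(a,b)`, with equality iff `c = a`. -/
theorem fidelity_ratio_lemma
    {d : ℕ} (a b c : Fin d → ℝ)
    (ha : IsProbVec a) (hb : IsProbVec b) (hc : IsProbVec c)
    (hbpos : ∀ i, 0 < b i)
    (hratio : StrictAnti (fun i : Fin d => a i / b i))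
    (hpart : ∀ k : ℕ, k ≤ d →
      ∑ i ∈ Finset.univ.filter (fun i : Fin d => (i : ℕ) < k), a i ≤
      ∑ i ∈ Finset.univ.filter (fun i : Fin d => (i : ℕ) < k), c i) :
    fidelity c b ≤ fidelity a b ∧ (fidelity c b = fidelity a b ↔ c = a) := by
  have hlast : ∀ i, a i = 0 → ∀ j, i ≤ j → j = i := fun i hi j hij => by
    by_contra hne
    have h := hratio (lt_of_le_of_ne hij (Ne.symm hne))
    simp only [hi, zero_div] at h
    exact absurd h (div_nonneg (ha.1 j) (hbpos j).le).not_gt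
  have hc0 : ∀ i, a i = 0 → c i = 0 := fun i hi =>
    eq_zero_of_partial_sums_le ha hc i (fun j hij => by rw [hlast i hi j hij, hi])
      (hpart i i.2.le)
  have hapos : ∀ i, a i ≠ 0 → 0 < a i := fun i hi => lt_of_le_of_ne (ha.1 i) (Ne.symm hi)
  set v : Fin d → ℝ := fun i => √(b i / a i) / 2 with hv
  have hv0 : ∀ i, 0 ≤ v i := fun i => by positivity
  set W := ∑ i, v i
  have hvW : ∀ i, v i ≤ W := fun i => single_le_sum (fun j _ => hv0 j) (mem_univ i)
  -- the junk value of `v` at a vanishing last entry of `a` is replaced to keep monotonicity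
  set w : Fin d → ℝ := fun i => if a i = 0 then W else v i with hw
  have hwW : ∀ i, w i ≤ W := fun i => by
    by_cases h : a i = 0
    · simp [hw, h]
    · simpa [hw, h] using hvW i
  have hmono : Monotone w := fun i j hij => by
    by_cases hj : a j = 0
    · simpa [hw, hj] using hwW i
    · have hi : a i ≠ 0 := fun hi => hj (by rw [hlast i hi j hij, hi])
      simp only [hw, hv, hi, hj, if_false]
      have h := one_div_le_one_div_of_le (div_pos (hapos j hj) (hbpos j)) (hratio.antitone hij)
      simp only [one_div_div] at h
      gcongr
  have habel : ∑ i, w i * (c i - a i) ≤ 0 := by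
    have h := sum_mul_le_of_partial_sums_nonneg w (fun i => c i - a i) W hmono hwW
      (fun k hk => by rw [sum_sub_distrib]; linarith [hpart k hk])
    rwa [sum_sub_distrib, ha.2, hc.2, sub_self, mul_zero] at h
  have hw0 : ∀ i, 0 ≤ w i * (√(c i) - √(a i)) ^ 2 := fun i => by
    have : 0 ≤ w i := by
      by_cases h : a i = 0
      · simpa [hw, h] using (hv0 i).trans (hvW i)
      · simpa [hw, h] using hv0 i
    positivity
  have hsum : ∑ i, √(c i * b i) = ∑ i, √(a i * b i) + ∑ i, w i * (c i - a i)
      - ∑ i, w i * (√(c i) - √(a i)) ^ 2 := by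
    rw [← sum_add_distrib, ← sum_sub_distrib]
    refine sum_congr rfl fun i _ => ?_
    by_cases h : a i = 0
    · simp [h, hc0 i h]
    · simpa only [hw, hv, h, if_false] using
        sqrt_mul_eq_tangent_sub_sq (hapos i h) (hbpos i) (hc.1 i)
  have hrem := sum_nonneg fun i (_ : i ∈ univ) => hw0 i
  have hcn : 0 ≤ ∑ i, √(c i * b i) := by positivity
  have han : 0 ≤ ∑ i, √(a i * b i) := by positivity
  refine ⟨pow_le_pow_left₀ hcn (by linarith) 2, fun heq => ?_, fun h => by rw [h]⟩
  have heq' := (pow_left_inj₀ hcn han two_ne_zero).1 heq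
  have hzero := (sum_eq_zero_iff_of_nonneg fun i _ => hw0 i).1
    (le_antisymm (by linarith) hrem)
  funext i
  by_cases h : a i = 0
  · rw [h, hc0 i h]
  · have hwi : w i ≠ 0 := by
      simp only [hw, hv, h, if_false]
      have := Real.sqrt_pos.2 (div_pos (hbpos i) (hapos i h))
      positivity
    have hs := pow_eq_zero_iff two_ne_zero |>.1
      ((mul_eq_zero.1 (hzero i (mem_univ i))).resolve_left hwi)
    exact (Real.sqrt_inj (hc.1 i) (ha.1 i)).1 (sub_eq_zero.1 hs)
end
end

section
/- Work extracted at instantaneous Carnot efficiency equals the free energy change: fix energies E_1,…,E_d ∈ ℝ and define, for T > 0, the partition function Z(T) = Σ_i e^{−E_i/T}, the Gibbs distribution γ(T)_i = e^{−E_i/T}/Z(T), and the average energy U(T) = Σ_i γ(T)_i E_i. Then for all temperatures 0 < T_c ≤ T_{c'} and every T_h > 0, ∫_{T_c}^{T_{c'}} (T_h/T − 1)·U′(T) dT = T_h·( D(γ(T_c) ‖ γ(T_h)) − D(γ(T_{c'}) ‖ γ(T_h)) ), where D(p‖q) = Σ_i p_i log(p_i/q_i) is the relative entropy and U′ denotes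 the derivative of U with respect to T. -/
open Finset intervalIntegral

noncomputable section

/-- Partition function `Z(T) = Σ_i e^{-E_i/T}`. -/
def partZ {d : ℕ} (E : Fin d → ℝ) (T : ℝ) : ℝ := ∑ i, Real.exp (-(E i) / T)

/-- Gibbs distribution `γ(T)_i = e^{-E_i/T} / Z(T)`. -/
def gibbs {d : ℕ} (E : Fin d → ℝ) (T : ℝ) : Fin d → ℝ :=
  fun i => Real.exp (-(E i) / T) / partZ E T

/-- Average energy `U(T) = Σ_i γ(T)_i E_i`. -/
def avgE {d : ℕ} (E : Fin d → ℝ) (T : ℝ) : ℝ := ∑ i, gibbs E T i * E i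

/-- Relative entropy `D(p‖q) = Σ_i p_i log(p_i/q_i)`. -/
def relEnt {d : ℕ} (p q : Fin d → ℝ) : ℝ := ∑ i, p i * Real.log (p i / q i)

theorem partZ_pos {d : ℕ} [NeZero d] (E : Fin d → ℝ) (T : ℝ) : 0 < partZ E T :=
  Finset.sum_pos (fun _ _ => Real.exp_pos _) Finset.univ_nonempty

theorem sum_gibbs {d : ℕ} [NeZero d] (E : Fin d → ℝ) (T : ℝ) : ∑ i, gibbs E T i = 1 := by
  simp only [gibbs, ← Finset.sum_div]
  exact div_self (partZ_pos E T).ne'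

theorem contDiffAt_exp_neg_div (a : ℝ) {T : ℝ} (hT : T ≠ 0) :
    ContDiffAt ℝ 1 (fun t : ℝ => Real.exp (-a / t)) T :=
  (contDiffAt_const.div contDiffAt_id hT).exp

theorem contDiffAt_avgE {d : ℕ} [NeZero d] (E : Fin d → ℝ) {T : ℝ} (hT : T ≠ 0) :
    ContDiffAt ℝ 1 (avgE E) T := by
  refine ContDiffAt.sum fun i _ => ContDiffAt.mul (ContDiffAt.div ?_ ?_ (partZ_pos E T).ne')
    contDiffAt_const
  · exact contDiffAt_exp_neg_div (E i) hT
  · exact ContDiffAt.sum fun j _ => contDiffAt_exp_neg_div (E j) hT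

theorem continuousOn_deriv_avgE {d : ℕ} [NeZero d] (E : Fin d → ℝ) :
    ContinuousOn (deriv (avgE E)) (Set.Ioi 0) := by
  have h : ContDiffOn ℝ 1 (avgE E) (Set.Ioi 0) := fun T hT =>
    (contDiffAt_avgE E (ne_of_gt hT)).contDiffWithinAt
  exact h.continuousOn_deriv_of_isOpen isOpen_Ioi le_rfl

theorem hasDerivAt_log_partZ {d : ℕ} [NeZero d] (E : Fin d → ℝ) {T : ℝ} (hT : T ≠ 0) :
    HasDerivAt (fun t => Real.log (partZ E t)) (avgE E T / T ^ 2) T := by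
  have h (i : Fin d) : HasDerivAt (fun t : ℝ => Real.exp (-(E i) / t))
      (Real.exp (-(E i) / T) * (E i / T ^ 2)) T := by
    have h := ((hasDerivAt_const T (-(E i))).div (hasDerivAt_id T) hT).exp
    simpa using h
  have hZ : HasDerivAt (partZ E) (∑ i, Real.exp (-(E i) / T) * (E i / T ^ 2)) T :=
    HasDerivAt.fun_sum fun i _ => h i
  refine (hZ.log (partZ_pos E T).ne').congr_deriv ?_
  simp only [avgE, gibbs, Finset.sum_div]
  exact Finset.sum_congr rfl fun i _ => by ring

theorem relEnt_gibbs {d : ℕ} [NeZero d] (E : Fin d → ℝ) (T S : ℝ) :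
    relEnt (gibbs E T) (gibbs E S) =
      avgE E T * (1 / S - 1 / T) - Real.log (partZ E T) + Real.log (partZ E S) := by
  have hlog (t : ℝ) (i : Fin d) :
      Real.log (gibbs E t i) = -(E i) / t - Real.log (partZ E t) := by
    rw [gibbs, Real.log_div (Real.exp_pos _).ne' (partZ_pos E t).ne', Real.log_exp]
  have hne (t : ℝ) (i : Fin d) : gibbs E t i ≠ 0 :=
    (div_pos (Real.exp_pos _) (partZ_pos E t)).ne'
  have hterm (i : Fin d) : gibbs E T i * Real.log (gibbs E T i / gibbs E S i) =
      gibbs E T i * E i * (1 / S - 1 / T) +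
        gibbs E T i * (Real.log (partZ E S) - Real.log (partZ E T)) := by
    rw [Real.log_div (hne T i) (hne S i), hlog, hlog]
    ring
  simp only [relEnt, hterm]
  rw [Finset.sum_add_distrib, ← Finset.sum_mul, ← Finset.sum_mul, sum_gibbs, avgE]
  ring

theorem hasDerivAt_relEnt_gibbs {d : ℕ} [NeZero d] (E : Fin d → ℝ) {T : ℝ} (hT : T ≠ 0)
    (S : ℝ) :
    HasDerivAt (fun t => relEnt (gibbs E t) (gibbs E S))
      ((1 / S - 1 / T) * deriv (avgE E) T) T := by
  simp only [relEnt_gibbs]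
  have hU : HasDerivAt (avgE E) (deriv (avgE E) T) T :=
    ((contDiffAt_avgE E hT).differentiableAt one_ne_zero).hasDerivAt
  have hI : HasDerivAt (fun t : ℝ => 1 / S - 1 / t) (1 / T ^ 2) T := by
    simpa using (hasDerivAt_inv hT).const_sub (1 / S)
  refine (((hU.mul hI).sub (hasDerivAt_log_partZ E hT)).add_const
    (Real.log (partZ E S))).congr_deriv ?_
  ring

/-- the work extracted at instantaneous Carnot efficiency while the
working body heats from `T_c` to `T_{c'}` equals the free energy change:
`∫_{T_c}^{T_c'} (T_h/T - 1) U'(T) dT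
  = T_h (D(γ(T_c)‖γ(T_h)) - D(γ(T_{c'})‖γ(T_h)))`. -/
theorem carnot_work_eq_free_energy_change
    {d : ℕ} (E : Fin d → ℝ) (Tc Tc' Th : ℝ)
    (hTc : 0 < Tc) (hTcc : Tc ≤ Tc') (hTh : 0 < Th) :
    ∫ T in Tc..Tc', (Th / T - 1) * deriv (avgE E) T =
      Th * (relEnt (gibbs E Tc) (gibbs E Th) - relEnt (gibbs E Tc') (gibbs E Th)) := by
  rcases Nat.eq_zero_or_pos d with rfl | hd
  · have hU : avgE E = fun _ => 0 := by
      ext T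
      simp [avgE]
    simp [hU, relEnt]
  have : NeZero d := ⟨hd.ne'⟩
  have hpos : ∀ T ∈ Set.uIcc Tc Tc', 0 < T := fun T hT =>
    hTc.trans_le (Set.uIcc_of_le hTcc ▸ hT).1
  have hderiv : ∀ T ∈ Set.uIcc Tc Tc',
      HasDerivAt (fun t => -Th * relEnt (gibbs E t) (gibbs E Th))
        ((Th / T - 1) * deriv (avgE E) T) T := by
    intro T hT
    refine ((hasDerivAt_relEnt_gibbs E (hpos T hT).ne' Th).const_mul (-Th)).congr_deriv ?_
    have hT0 : T ≠ 0 := (hpos T hT).ne'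
    field_simp
    ring
  have hint : IntervalIntegrable (fun T => (Th / T - 1) * deriv (avgE E) T)
      MeasureTheory.volume Tc Tc' := by
    refine ContinuousOn.intervalIntegrable (ContinuousOn.mul ?_ ?_)
    · exact (continuousOn_const.div continuousOn_id fun T hT => (hpos T hT).ne').sub
        continuousOn_const
    · exact (continuousOn_deriv_avgE E).mono hpos
  rw [integral_eq_sub_of_hasDerivAt hderiv hint]
  ring
end
end
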